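/- (Theorem 3.1, uniqueness) Let u₁(r) and u₂(r) be two positive solutions of the radial equation (r^{N−1−ap}|u'|^{p−2}u')' + r^{N−1}( μ u^{p−1} r^{−(a+1)p} + u^{p_*−1} r^{−bp_*} ) = 0, and let (y₁, z₁) and (y₂, z₂) be the corresponding solutions of the autonomous system y' = δy + |z|^{(2−p)/(p−1)}z, z' = −δz − |y|^{p_*−2}y − μ|y|^{p−2}y under t = log r, y = r^δ u, z = r^{(1+δ)(p−1)}|u'|^{p−2}u'. If max_{t∈ℝ} y₁(t) = y₁(0) = [ (N/(N−(a+1−b)p)) (δ^p − μ) ]^{1/(p_*−p)} and y₂(0) = y₁(0), then (y₁(t), z₁(t)) = (y₂(t), z₂(t)) for all t, and hence u₁ = u₂. -/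

import Mathlib

open MeasureTheory Filter Topology Set

noncomputable section

/-- `y(t) = r^δ u(r)` with `r = e^t`. -/
def yf (u : ℝ → ℝ) (δ t : ℝ) : ℝ := Real.exp (δ * t) * u (Real.exp t)

/-- `z(t) = r^{(1+δ)(p−1)} |u'(r)|^{p−2} u'(r)` with `r = e^t`. -/
def zf (u : ℝ → ℝ) (δ p t : ℝ) : ℝ :=
  Real.exp ((1 + δ) * (p - 1) * t) * |deriv u (Real.exp t)| ^ (p - 2) * deriv u (Real.exp t)

/-- A function on `ℝ` whose derivative is bounded below by a positive constant and grows
superlinearly in the function cannot exist for all times. -/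
lemma superlinear_blowup {σ c B m : ℝ} (hσ : 1 < σ) (hc : 0 < c) (hm : 0 < m)
    {s s' : ℝ → ℝ} (hs : ∀ t, HasDerivAt s (s' t) t) (hlow : ∀ t, m ≤ s' t)
    (hsup : ∀ t, 0 < s t → c * s t ^ σ - B * s t ≤ s' t) : False := by
  have hmono : Monotone fun t => s t - m * t := by
    have hd : ∀ t, HasDerivAt (fun t => s t - m * t) (s' t - m) t := fun t =>
      ((hs t).sub ((hasDerivAt_id t).const_mul m)).congr_deriv (by simp)
    refine monotone_of_deriv_nonneg (fun t => (hd t).differentiableAt) fun t => ?_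
    rw [(hd t).deriv]
    linarith [hlow t]
  have htop : Tendsto s atTop atTop := by
    have h1 : Tendsto (fun t => m * t + (s 0 - m * 0)) atTop atTop :=
      tendsto_atTop_add_const_right _ _ (tendsto_id.const_mul_atTop hm)
    refine tendsto_atTop_mono' _ ?_ h1
    filter_upwards [eventually_ge_atTop 0] with t ht
    have := hmono ht
    simp only at this
    linarith
  have hev : ∀ᶠ t in atTop, 0 < s t ∧ 2 * B / c ≤ s t ^ (σ - 1) :=
    (htop.eventually_gt_atTop 0).and
      (((tendsto_rpow_atTop (by linarith : 0 < σ - 1)).comp htop).eventually_ge_atTop _)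
  obtain ⟨T, hT⟩ := eventually_atTop.1 hev
  have hd : ∀ t ∈ Ici T, HasDerivAt (fun t => s t ^ (1 - σ) + (σ - 1) * c / 2 * t)
      (s' t * (1 - σ) * s t ^ (1 - σ - 1) + (σ - 1) * c / 2) t := fun t ht =>
    (((hs t).rpow_const (p := 1 - σ) (Or.inl (hT t ht).1.ne')).add
      ((hasDerivAt_id t).const_mul ((σ - 1) * c / 2))).congr_deriv (by simp)
  have hanti : AntitoneOn (fun t => s t ^ (1 - σ) + (σ - 1) * c / 2 * t) (Ici T) := by
    refine antitoneOn_of_deriv_nonpos (convex_Ici T)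
      (fun t ht => (hd t ht).continuousAt.continuousWithinAt)
      (fun t ht => (hd t (interior_subset ht)).differentiableAt.differentiableWithinAt)
      fun t ht => ?_
    have ht' := interior_subset ht
    obtain ⟨h0, h1⟩ := hT t ht'
    rw [(hd t ht').deriv]
    have e1 : s t ^ σ = s t * s t ^ (σ - 1) := by
      rw [← Real.rpow_one_add' h0.le (by linarith)]; congr 1; ring
    have e2 : s t ^ (1 - σ - 1) * s t ^ σ = 1 := by
      rw [← Real.rpow_add h0]; simp
    have hP := Real.rpow_pos_of_pos h0 (1 - σ - 1)
    have h2 : c / 2 * s t ^ σ ≤ s' t := by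
      refine le_trans ?_ (hsup t h0)
      rw [div_le_iff₀ hc] at h1
      rw [e1]
      nlinarith
    have h3 : c / 2 ≤ s' t * s t ^ (1 - σ - 1) := by
      calc c / 2 = c / 2 * s t ^ σ * s t ^ (1 - σ - 1) := by
            rw [mul_assoc, mul_comm (s t ^ σ), e2, mul_one]
        _ ≤ _ := mul_le_mul_of_nonneg_right h2 hP.le
    nlinarith
  have hlin : Tendsto (fun t => (σ - 1) * c / 2 * t) atTop atTop :=
    tendsto_id.const_mul_atTop (half_pos (mul_pos (sub_pos.2 hσ) hc))
  obtain ⟨t, ht, htT⟩ := ((hlin.eventually_gt_atTop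
    (s T ^ (1 - σ) + (σ - 1) * c / 2 * T)).and (eventually_ge_atTop T)).exists
  have h1 := hanti self_mem_Ici htT htT
  have h2 := Real.rpow_pos_of_pos (hT t htT).1 (1 - σ)
  simp only at h1
  linarith

/-- Global uniqueness for a scalar autonomous equation with `C¹` right-hand side. -/
lemma eq_of_hasDerivAt_contDiff {F f g : ℝ → ℝ} (hF : ContDiff ℝ 1 F)
    (hf : ∀ t, HasDerivAt f (F (f t)) t) (hg : ∀ t, HasDerivAt g (F (g t)) t)
    {t₀ : ℝ} (h : f t₀ = g t₀) : f = g := by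
  have hfc : Continuous f := continuous_iff_continuousAt.2 fun t => (hf t).continuousAt
  have hgc : Continuous g := continuous_iff_continuousAt.2 fun t => (hg t).continuousAt
  have hclopen : IsClopen {t | f t = g t} := by
    refine ⟨isClosed_eq hfc hgc, isOpen_iff_mem_nhds.2 fun t ht => ?_⟩
    obtain ⟨K, S, hS, hK⟩ := (hF.contDiffAt (x := f t)).exists_lipschitzOnWith
    have hS' : S ∈ 𝓝 (g t) := by
      rw [← (show f t = g t from ht)]; exact hS
    exact ODE_solution_unique_of_eventually (v := fun _ => F) (s := fun _ => S)
      (Eventually.of_forall fun _ => hK)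
      ((hfc.continuousAt.eventually_mem hS).mono fun τ hτ => ⟨hf τ, hτ⟩)
      ((hgc.continuousAt.eventually_mem hS').mono fun τ hτ => ⟨hg τ, hτ⟩) ht
  have := hclopen.eq_univ ⟨t₀, h⟩
  exact funext fun t => this.ge (mem_univ t)

lemma abs_rpow_sub_two_mul_self {p x : ℝ} (hp : 1 < p) :
    abs (|x| ^ (p - 2) * x) = |x| ^ (p - 1) := by
  rcases eq_or_ne x 0 with rfl | hx
  · simp [Real.zero_rpow (by linarith : p - 1 ≠ 0)]
  · have h : 0 < |x| := abs_pos.2 hx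
    rw [abs_mul, abs_of_pos (Real.rpow_pos_of_pos h _)]
    nth_rewrite 2 [← Real.rpow_one |x|]
    rw [← Real.rpow_add h]
    congr 1
    ring

/-- The duality map of exponent `p / (p - 1)` inverts the one of exponent `p`. -/
lemma duality_map_inv {p x z : ℝ} (hp : 1 < p) (hz : z = |x| ^ (p - 2) * x) :
    |z| ^ (p / (p - 1) - 2) * z = x := by
  have hp1 : p - 1 ≠ 0 := by linarith
  rcases eq_or_ne x 0 with rfl | hx
  · simp [hz]
  · have h : 0 < |x| := abs_pos.2 hx
    have h1 : |z| = |x| ^ (p - 1) := by rw [hz, abs_rpow_sub_two_mul_self hp]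
    rw [h1, ← Real.rpow_mul h.le, hz, ← mul_assoc, ← Real.rpow_add h]
    have : (p - 1) * (p / (p - 1) - 2) + (p - 2) = 0 := by field_simp; ring
    rw [this, Real.rpow_zero, one_mul]

lemma mul_duality_map {p x z : ℝ} (hp : 1 < p) (hz : z = |x| ^ (p - 2) * x) :
    z * x = |z| ^ (p / (p - 1)) := by
  have hp1 : p - 1 ≠ 0 := by linarith
  have hσ : 0 < p / (p - 1) := div_pos (by linarith) (by linarith)
  rcases eq_or_ne z 0 with h0 | h0
  · simp [h0, Real.zero_rpow hσ.ne']
  · have h : 0 < |z| := abs_pos.2 h0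
    calc z * x = |z| ^ (p / (p - 1) - 2) * |z| ^ (2 : ℝ) := by
          rw [Real.rpow_two, sq_abs]
          linear_combination (-z) * duality_map_inv hp hz
      _ = _ := by rw [← Real.rpow_add h]; congr 1; ring

/-- The quantity `p δ q + (p - 1) |q|^{p/(p-1)} + μ`, the part of the energy depending on the
Riccati variable `q = z / y^{p-1}`. -/
def riccatiEnergy (p δ μ q : ℝ) : ℝ := p * δ * q + (p - 1) * |q| ^ (p / (p - 1)) + μ

lemma contDiff_riccatiEnergy {p : ℝ} (hp : 1 < p) (δ μ : ℝ) :
    ContDiff ℝ 1 (riccatiEnergy p δ μ) := by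
  have hσ : 1 < p / (p - 1) := by rw [lt_div_iff₀] <;> linarith
  have : ContDiff ℝ 1 fun q : ℝ => |q| ^ (p / (p - 1)) := contDiff_norm_rpow (E := ℝ) hσ
  unfold riccatiEnergy
  fun_prop

lemma le_riccatiEnergy {p δ : ℝ} (hp : 1 < p) (hδ : 0 < δ) (μ q : ℝ) :
    μ - δ ^ p ≤ riccatiEnergy p δ μ q := by
  have hconj : p.HolderConjugate (p / (p - 1)) := Real.HolderConjugate.conjExponent hp
  have h := Real.young_inequality_of_nonneg hδ.le (abs_nonneg q) hconj
  have hp1 : 0 < p - 1 := by linarith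
  have h' : p * (δ * |q|) ≤ p * (δ ^ p / p + |q| ^ (p / (p - 1)) / (p / (p - 1))) :=
    mul_le_mul_of_nonneg_left h (by linarith)
  have e : p * (δ ^ p / p + |q| ^ (p / (p - 1)) / (p / (p - 1))) =
      δ ^ p + (p - 1) * |q| ^ (p / (p - 1)) := by
    field_simp
  have h2 : p * δ * (-|q|) ≤ p * δ * q :=
    mul_le_mul_of_nonneg_left (neg_abs_le q) (by positivity)
  unfold riccatiEnergy
  nlinarith

/-- The minimum of `riccatiEnergy` is attained at one point only. -/
lemma riccatiEnergy_min_unique {p δ μ q₁ q₂ : ℝ} (hp : 1 < p) (hδ : 0 < δ)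
    (h₁ : riccatiEnergy p δ μ q₁ = μ - δ ^ p) (h₂ : riccatiEnergy p δ μ q₂ = μ - δ ^ p) :
    q₁ = q₂ := by
  have hσ : 1 < p / (p - 1) := by rw [lt_div_iff₀] <;> linarith
  have hp1 : 0 < p - 1 := by linarith
  have hneg : ∀ q, riccatiEnergy p δ μ q = μ - δ ^ p → q ≤ 0 := fun q hq => by
    by_contra! h0
    have h3 : 0 < δ ^ p := Real.rpow_pos_of_pos hδ p
    have : 0 ≤ p * δ * q + (p - 1) * |q| ^ (p / (p - 1)) := by positivity
    unfold riccatiEnergy at hq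
    linarith
  have hconv : StrictConvexOn ℝ (Ici 0)
      fun s : ℝ => (p / (p - 1) - 1)⁻¹ * s ^ (p / (p - 1)) + (-(p * δ)) * s := by
    have hlin : ConvexOn ℝ (Ici (0 : ℝ)) fun s : ℝ => (-(p * δ)) * s :=
      ((LinearMap.mulLeft ℝ (-(p * δ))).convexOn (convex_Ici 0))
    have hk : 0 < (p / (p - 1) - 1)⁻¹ := by
      apply inv_pos.2; linarith
    have := (strictConvexOn_rpow hσ)
    refine StrictConvexOn.add_convexOn ⟨this.1, fun x hx y hy hxy a b ha hb hab => ?_⟩ hlin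
    have h4 := mul_lt_mul_of_pos_left (this.2 hx hy hxy ha hb hab) hk
    simp only [smul_eq_mul] at h4 ⊢
    linarith
  have hk : (p / (p - 1) - 1)⁻¹ = p - 1 := by
    have : p / (p - 1) - 1 = (p - 1)⁻¹ := by field_simp; ring
    rw [this, inv_inv]
  have hval : ∀ s ∈ Ici (0 : ℝ), riccatiEnergy p δ μ (-s) =
      ((p / (p - 1) - 1)⁻¹ * s ^ (p / (p - 1)) + (-(p * δ)) * s) + μ := fun s hs => by
    rw [hk, riccatiEnergy, abs_neg, abs_of_nonneg hs]
    ring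
  have hmin : ∀ q, riccatiEnergy p δ μ q = μ - δ ^ p → IsMinOn
      (fun s : ℝ => (p / (p - 1) - 1)⁻¹ * s ^ (p / (p - 1)) + (-(p * δ)) * s) (Ici 0) (-q) :=
    fun q hq s hs => by
      have a1 := hval (-q) (by simpa using hneg q hq)
      have a2 := hval s hs
      have a3 := le_riccatiEnergy hp hδ μ (-s)
      rw [neg_neg] at a1
      simp only [mem_ofPred_eq]
      linarith
  have := hconv.eq_of_isMinOn (hmin q₁ h₁) (hmin q₂ h₂) (by simpa using hneg q₁ h₁)
    (by simpa using hneg q₂ h₂)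
  linarith

/-- The conserved energy and the Riccati equation of the autonomous system. -/
lemma riccati_of_system {p ps δ μ : ℝ} (hp : 1 < p) (hps : p < ps) {y z v : ℝ → ℝ}
    (hpos : ∀ t, 0 < y t) (hzv : ∀ t, z t = |v t| ^ (p - 2) * v t)
    (hy : ∀ t, HasDerivAt y (δ * y t + v t) t)
    (hz : ∀ t, HasDerivAt z (-(δ * z t) - y t ^ (ps - 1) - μ * y t ^ (p - 1)) t) :
    ∃ C, ∀ t,
      HasDerivAt (fun t => z t * y t ^ (1 - p))
        (-(riccatiEnergy p δ μ (z t * y t ^ (1 - p)) + y t ^ (ps - p))) t ∧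
      riccatiEnergy p δ μ (z t * y t ^ (1 - p)) + p / ps * y t ^ (ps - p) = C * y t ^ (-p) := by
  have hσ : 1 < p / (p - 1) := by rw [lt_div_iff₀] <;> linarith
  have hp0 : p ≠ 0 := by linarith
  have hps0 : ps ≠ 0 := by linarith
  have hp1 : p - 1 ≠ 0 := by linarith
  have hE : ∀ t, HasDerivAt (fun t => δ * (y t * z t) + (p - 1) / p * |z t| ^ (p / (p - 1))
      + μ / p * y t ^ p + 1 / ps * y t ^ ps) 0 t := fun t => by
    have h1 := ((hy t).mul (hz t)).const_mul δ
    have h2 := ((hasDerivAt_abs_rpow (z t) hσ).comp t (hz t)).const_mul ((p - 1) / p)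
    have h3 := ((hy t).rpow_const (p := p) (Or.inl (hpos t).ne')).const_mul (μ / p)
    have h4 := ((hy t).rpow_const (p := ps) (Or.inl (hpos t).ne')).const_mul (1 / ps)
    refine (((h1.add h2).add h3).add h4).congr_deriv ?_
    have e : p / (p - 1) * |z t| ^ (p / (p - 1) - 2) * z t = p / (p - 1) * v t := by
      rw [mul_assoc, duality_map_inv hp (hzv t)]
    rw [e]
    field_simp
    ring
  have hconst : ∀ t, _ = _ := fun t => is_const_of_deriv_eq_zero
    (fun t => (hE t).differentiableAt) (fun t => (hE t).deriv) t 0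
  refine ⟨p * (δ * (y 0 * z 0) + (p - 1) / p * |z 0| ^ (p / (p - 1))
      + μ / p * y 0 ^ p + 1 / ps * y 0 ^ ps), fun t => ?_⟩
  have ht := hpos t
  have e0 : y t ^ (1 - p) = y t * y t ^ (-p) := by
    rw [sub_eq_add_neg, Real.rpow_add ht, Real.rpow_one]
  have e1 : y t ^ p * y t ^ (-p) = 1 := by rw [← Real.rpow_add ht]; simp
  have e2 : y t ^ (ps - p) = y t ^ ps * y t ^ (-p) := by
    rw [sub_eq_add_neg, Real.rpow_add ht]
  have e3 : |z t * y t ^ (1 - p)| ^ (p / (p - 1)) = |z t| ^ (p / (p - 1)) * y t ^ (-p) := by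
    rw [abs_mul, abs_of_pos (Real.rpow_pos_of_pos ht (1 - p)),
      Real.mul_rpow (abs_nonneg _) (Real.rpow_nonneg ht.le _), ← Real.rpow_mul ht.le]
    congr 2
    field_simp
    ring
  have e4 : y t ^ (ps - 1) * y t ^ (1 - p) = y t ^ (ps - p) := by
    rw [← Real.rpow_add ht]; congr 1; ring
  have e5 : y t ^ (p - 1) * y t ^ (1 - p) = 1 := by rw [← Real.rpow_add ht]; simp
  have e6 : y t ^ (1 - p - 1) = y t ^ (-p) := by congr 1; ring
  constructor
  · refine ((hz t).mul ((hy t).rpow_const (p := 1 - p) (Or.inl ht.ne'))).congr_deriv ?_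
    have hm := mul_duality_map hp (hzv t)
    rw [riccatiEnergy, e3, ← hm, e6, ← e4]
    linear_combination (-μ) * e5 + (p - 1) * δ * z t * e0
  · rw [← hconst t, riccatiEnergy, e3, e0, e2]
    field_simp
    linear_combination (-μ * ps) * e1

/-- Positive solutions of the autonomous system defined for all times which pass through the
critical height at time `0` have zero energy; hence the Riccati variable solves a closed equation
and starts at the minimum of `riccatiEnergy`. -/
lemma riccati_of_critical_height {p ps δ μ : ℝ} (hp : 1 < p) (hps : p < ps) (hδ : 0 < δ)
    (hμ : 0 < μ) {y z v : ℝ → ℝ}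
    (hpos : ∀ t, 0 < y t) (hzv : ∀ t, z t = |v t| ^ (p - 2) * v t)
    (hy : ∀ t, HasDerivAt y (δ * y t + v t) t)
    (hz : ∀ t, HasDerivAt z (-(δ * z t) - y t ^ (ps - 1) - μ * y t ^ (p - 1)) t)
    (h0 : p / ps * y 0 ^ (ps - p) = δ ^ p - μ) :
    (∀ t, HasDerivAt (fun t => z t * y t ^ (1 - p))
        ((ps / p - 1) * riccatiEnergy p δ μ (z t * y t ^ (1 - p))) t) ∧
    (∀ t, riccatiEnergy p δ μ (z t * y t ^ (1 - p)) = -(p / ps * y t ^ (ps - p))) ∧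
    riccatiEnergy p δ μ (z 0 * y 0 ^ (1 - p)) = μ - δ ^ p := by
  obtain ⟨C, hC⟩ := riccati_of_system hp hps hpos hzv hy hz
  have hσ : 1 < p / (p - 1) := by rw [lt_div_iff₀] <;> linarith
  have hps0 : 0 < ps := by linarith
  have hκ : 0 < 1 - p / ps := by rw [sub_pos, div_lt_one hps0]; exact hps
  have hC0 : 0 ≤ C := by
    have h1 := (hC 0).2
    have h2 := le_riccatiEnergy hp hδ μ (z 0 * y 0 ^ (1 - p))
    have h3 : 0 ≤ C * y 0 ^ (-p) := by linarith
    exact nonneg_of_mul_nonneg_left h3 (Real.rpow_pos_of_pos (hpos 0) _)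
  have hC1 : C = 0 := by
    by_contra hne
    have hCpos : 0 < C := lt_of_le_of_ne hC0 (Ne.symm hne)
    refine superlinear_blowup (B := p * δ) (m := min C (1 - p / ps)) hσ
      (by linarith : 0 < p - 1) (lt_min hCpos hκ) (fun t => (hC t).1.neg) (fun t => ?_)
      fun t ht => ?_
    · have h1 := (hC t).2
      rw [neg_neg]
      have ha := Real.rpow_pos_of_pos (hpos t) (-p)
      have hb := Real.rpow_pos_of_pos (hpos t) (ps - p)
      have h2 : riccatiEnergy p δ μ (z t * y t ^ (1 - p)) + y t ^ (ps - p) =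
          C * y t ^ (-p) + (1 - p / ps) * y t ^ (ps - p) := by linarith
      rw [h2]
      rcases le_total (y t) 1 with hle | hle
      · have h3 : 1 ≤ y t ^ (-p) :=
          Real.one_le_rpow_of_pos_of_le_one_of_nonpos (hpos t) hle (by linarith)
        have : 0 ≤ (1 - p / ps) * y t ^ (ps - p) := by positivity
        exact (min_le_left _ _).trans (by nlinarith)
      · have h3 : 1 ≤ y t ^ (ps - p) := Real.one_le_rpow hle (by linarith)
        have : 0 ≤ C * y t ^ (-p) := by positivity
        exact (min_le_right _ _).trans (by nlinarith)
    · have hb := Real.rpow_pos_of_pos (hpos t) (ps - p)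
      simp only [Pi.neg_apply] at ht ⊢
      rw [neg_neg, riccatiEnergy, ← abs_neg (z t * y t ^ (1 - p)), abs_of_pos ht]
      linarith
  have hG : ∀ t, riccatiEnergy p δ μ (z t * y t ^ (1 - p)) = -(p / ps * y t ^ (ps - p)) :=
    fun t => by
      have := (hC t).2
      rw [hC1] at this
      linarith
  refine ⟨fun t => (hC t).1.congr_deriv ?_, hG, ?_⟩
  · rw [hG]
    have hp0 : p ≠ 0 := by linarith
    field_simp
    ring
  · rw [hG, h0]; ring

/-- Two positive global solutions of the autonomous system passing through the critical height
at time `0` coincide. -/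
lemma system_unique {p ps δ μ : ℝ} (hp : 1 < p) (hps : p < ps) (hδ : 0 < δ) (hμ : 0 < μ)
    {y₁ z₁ v₁ y₂ z₂ v₂ : ℝ → ℝ}
    (hpos₁ : ∀ t, 0 < y₁ t) (hzv₁ : ∀ t, z₁ t = |v₁ t| ^ (p - 2) * v₁ t)
    (hy₁ : ∀ t, HasDerivAt y₁ (δ * y₁ t + v₁ t) t)
    (hz₁ : ∀ t, HasDerivAt z₁ (-(δ * z₁ t) - y₁ t ^ (ps - 1) - μ * y₁ t ^ (p - 1)) t)
    (h₁ : p / ps * y₁ 0 ^ (ps - p) = δ ^ p - μ)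
    (hpos₂ : ∀ t, 0 < y₂ t) (hzv₂ : ∀ t, z₂ t = |v₂ t| ^ (p - 2) * v₂ t)
    (hy₂ : ∀ t, HasDerivAt y₂ (δ * y₂ t + v₂ t) t)
    (hz₂ : ∀ t, HasDerivAt z₂ (-(δ * z₂ t) - y₂ t ^ (ps - 1) - μ * y₂ t ^ (p - 1)) t)
    (h₂ : p / ps * y₂ 0 ^ (ps - p) = δ ^ p - μ) (t : ℝ) :
    y₁ t = y₂ t ∧ z₁ t = z₂ t := by
  obtain ⟨hd₁, hG₁, hi₁⟩ := riccati_of_critical_height hp hps hδ hμ hpos₁ hzv₁ hy₁ hz₁ h₁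
  obtain ⟨hd₂, hG₂, hi₂⟩ := riccati_of_critical_height hp hps hδ hμ hpos₂ hzv₂ hy₂ hz₂ h₂
  have hq := eq_of_hasDerivAt_contDiff (F := fun q => (ps / p - 1) * riccatiEnergy p δ μ q)
    (contDiff_const.mul (contDiff_riccatiEnergy hp δ μ)) hd₁ hd₂
    (riccatiEnergy_min_unique hp hδ hi₁ hi₂)
  have hqt : z₁ t * y₁ t ^ (1 - p) = z₂ t * y₂ t ^ (1 - p) := congrFun hq t
  have hyt : y₁ t = y₂ t := by
    have h3 := hG₁ t
    rw [hqt, hG₂ t] at h3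
    have hne : p / ps ≠ 0 := div_ne_zero (by linarith) (by linarith)
    exact Real.rpow_left_injOn (by linarith : ps - p ≠ 0) (hpos₁ t).le (hpos₂ t).le
      (mul_left_cancel₀ hne (neg_injective h3)).symm
  refine ⟨hyt, ?_⟩
  rw [hyt] at hqt
  exact mul_right_cancel₀ (Real.rpow_pos_of_pos (hpos₂ t) _).ne' hqt

lemma yf_pos {u : ℝ → ℝ} (hpos : ∀ r ∈ Ioi (0 : ℝ), 0 < u r) (δ t : ℝ) : 0 < yf u δ t :=
  mul_pos (Real.exp_pos _) (hpos _ (Real.exp_pos _))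

lemma zf_eq (u : ℝ → ℝ) (δ p t : ℝ) :
    zf u δ p t = |Real.exp ((1 + δ) * t) * deriv u (Real.exp t)| ^ (p - 2) *
      (Real.exp ((1 + δ) * t) * deriv u (Real.exp t)) := by
  rw [zf, abs_mul, abs_of_pos (Real.exp_pos _),
    Real.mul_rpow (Real.exp_pos _).le (abs_nonneg _), ← Real.exp_mul]
  have : Real.exp ((1 + δ) * (p - 1) * t) =
      Real.exp ((1 + δ) * t * (p - 2)) * Real.exp ((1 + δ) * t) := by
    rw [← Real.exp_add]; congr 1; ring
  rw [this]
  ring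

lemma hasDerivAt_yf {u : ℝ → ℝ} (hdiff : ∀ r ∈ Ioi (0 : ℝ), DifferentiableAt ℝ u r) (δ t : ℝ) :
    HasDerivAt (yf u δ) (δ * yf u δ t + Real.exp ((1 + δ) * t) * deriv u (Real.exp t)) t := by
  have h1 : HasDerivAt (fun t : ℝ => Real.exp (δ * t)) (Real.exp (δ * t) * δ) t := by
    simpa using ((hasDerivAt_id t).const_mul δ).exp
  have h2 := (hdiff _ (Real.exp_pos t)).hasDerivAt.comp t (Real.hasDerivAt_exp t)
  refine (h1.mul h2).congr_deriv ?_
  have : Real.exp ((1 + δ) * t) = Real.exp (δ * t) * Real.exp t := by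
    rw [← Real.exp_add]; congr 1; ring
  rw [this, yf]
  simp only [Function.comp_apply]
  ring

lemma hasDerivAt_zf {n p a b μ ps δ : ℝ} {u : ℝ → ℝ}
    (hδ : δ * p = n - (a + 1) * p) (hps : (δ + b) * ps = n)
    (hpos : ∀ r ∈ Ioi (0 : ℝ), 0 < u r)
    (hode : ∀ r ∈ Ioi (0 : ℝ),
      HasDerivAt (fun s : ℝ => s ^ (n - 1 - a * p) * |deriv u s| ^ (p - 2) * deriv u s)
        (-(r ^ (n - 1) *
          (μ * u r ^ (p - 1) / r ^ ((a + 1) * p) + u r ^ (ps - 1) / r ^ (b * ps)))) r) (t : ℝ) :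
    HasDerivAt (zf u δ p)
      (-(δ * zf u δ p t) - yf u δ t ^ (ps - 1) - μ * yf u δ t ^ (p - 1)) t := by
  have hz : zf u δ p = fun t => Real.exp (-δ * t) * (Real.exp t ^ (n - 1 - a * p) *
      |deriv u (Real.exp t)| ^ (p - 2) * deriv u (Real.exp t)) := by
    funext t
    rw [zf, ← Real.exp_mul, ← mul_assoc, ← mul_assoc, ← Real.exp_add]
    congr 3
    linear_combination t * hδ
  have h1 : HasDerivAt (fun t : ℝ => Real.exp (-δ * t)) (Real.exp (-δ * t) * -δ) t := by
    simpa using ((hasDerivAt_id t).const_mul (-δ)).exp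
  have h2 := (hode _ (Real.exp_pos t)).comp t (Real.hasDerivAt_exp t)
  have h3 := h1.mul h2
  rw [hz]
  refine h3.congr_deriv ?_
  have hu := hpos _ (Real.exp_pos t)
  simp only [Function.comp_apply, yf]
  rw [Real.mul_rpow (Real.exp_pos _).le hu.le, Real.mul_rpow (Real.exp_pos _).le hu.le]
  simp only [← Real.exp_mul]
  have e1 : Real.exp (δ * t * (p - 1)) = Real.exp (-δ * t) * Real.exp (t * (n - 1)) *
      Real.exp t / Real.exp (t * ((a + 1) * p)) := by
    rw [← Real.exp_add, ← Real.exp_add, ← Real.exp_sub]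
    congr 1
    linear_combination t * hδ
  have e2 : Real.exp (δ * t * (ps - 1)) = Real.exp (-δ * t) * Real.exp (t * (n - 1)) *
      Real.exp t / Real.exp (t * (b * ps)) := by
    rw [← Real.exp_add, ← Real.exp_add, ← Real.exp_sub]
    congr 1
    linear_combination t * hps
  rw [e1, e2]
  ring

/-- Theorem 3.1, uniqueness: if `u₁, u₂` are positive solutions of the
radial Euler–Lagrange ODE whose associated trajectories satisfy
`max y₁ = y₁(0) = [ (N/(N−(a+1−b)p)) (δ^p − μ) ]^{1/(p_*−p)}` and `y₂(0) = y₁(0)`,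
then `(y₁, z₁) = (y₂, z₂)` and `u₁ = u₂` on `(0, ∞)`. -/
theorem uniqueness_radial (N : ℕ) (p a b μ ps δ : ℝ)
    (hp : 1 < p) (hpN : p < N) (ha : 0 ≤ a) (ha' : a < ((N : ℝ) - p) / p)
    (hb : a ≤ b) (hb' : b < a + 1)
    (hps : ps = (N : ℝ) * p / ((N : ℝ) - (a + 1 - b) * p))
    (hδ : δ = ((N : ℝ) - (a + 1) * p) / p)
    (hμ : 0 < μ) (hμ' : μ < δ ^ p)
    (u₁ u₂ : ℝ → ℝ)
    (hpos₁ : ∀ r ∈ Ioi (0 : ℝ), 0 < u₁ r)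
    (hpos₂ : ∀ r ∈ Ioi (0 : ℝ), 0 < u₂ r)
    (hdiff₁ : ∀ r ∈ Ioi (0 : ℝ), DifferentiableAt ℝ u₁ r)
    (hdiff₂ : ∀ r ∈ Ioi (0 : ℝ), DifferentiableAt ℝ u₂ r)
    (hode₁ : ∀ r ∈ Ioi (0 : ℝ),
      HasDerivAt (fun s : ℝ => s ^ ((N : ℝ) - 1 - a * p) * |deriv u₁ s| ^ (p - 2) * deriv u₁ s)
        (-(r ^ ((N : ℝ) - 1) *
          (μ * u₁ r ^ (p - 1) / r ^ ((a + 1) * p) + u₁ r ^ (ps - 1) / r ^ (b * ps)))) r)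
    (hode₂ : ∀ r ∈ Ioi (0 : ℝ),
      HasDerivAt (fun s : ℝ => s ^ ((N : ℝ) - 1 - a * p) * |deriv u₂ s| ^ (p - 2) * deriv u₂ s)
        (-(r ^ ((N : ℝ) - 1) *
          (μ * u₂ r ^ (p - 1) / r ^ ((a + 1) * p) + u₂ r ^ (ps - 1) / r ^ (b * ps)))) r)
    (hmax : ∀ t : ℝ, yf u₁ δ t ≤ yf u₁ δ 0)
    (hval : yf u₁ δ 0 =
      ((N : ℝ) / ((N : ℝ) - (a + 1 - b) * p) * (δ ^ p - μ)) ^ (1 / (ps - p)))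
    (hval₂ : yf u₂ δ 0 = yf u₁ δ 0) :
    (∀ t : ℝ, yf u₁ δ t = yf u₂ δ t ∧ zf u₁ δ p t = zf u₂ δ p t) ∧
    ∀ r ∈ Ioi (0 : ℝ), u₁ r = u₂ r := by
  have hp0 : 0 < p := by linarith
  have hD : 0 < (N : ℝ) - (a + 1 - b) * p := by nlinarith
  have hN : 0 < (N : ℝ) := by linarith
  have hδ0 : 0 < δ := by
    have : δ = ((N : ℝ) - p) / p - a := by rw [hδ]; field_simp; ring
    linarith
  have hδp : δ * p = (N : ℝ) - (a + 1) * p := by rw [hδ]; field_simp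
  have hpps : p < ps := by
    rw [hps, lt_div_iff₀ hD]
    nlinarith [mul_pos hp0 (mul_pos (by linarith : 0 < a + 1 - b) hp0)]
  have hsum : (δ + b) * ps = N := by
    have h : (δ + b) * p = (N : ℝ) - (a + 1 - b) * p := by linear_combination hδp
    rw [hps, ← mul_div_assoc, div_eq_iff hD.ne', ← h]
    ring
  have hcrit : p / ps * yf u₁ δ 0 ^ (ps - p) = δ ^ p - μ := by
    have hB : 0 < (N : ℝ) / ((N : ℝ) - (a + 1 - b) * p) * (δ ^ p - μ) :=
      mul_pos (div_pos hN hD) (by linarith)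
    rw [hval, ← Real.rpow_mul hB.le, one_div_mul_cancel (by linarith : ps - p ≠ 0),
      Real.rpow_one, hps]
    generalize (N : ℝ) - (a + 1 - b) * p = D at hD
    field_simp
  have key := system_unique hp hpps hδ0 hμ (yf_pos hpos₁ δ) (zf_eq u₁ δ p)
    (hasDerivAt_yf hdiff₁ δ) (hasDerivAt_zf hδp hsum hpos₁ hode₁) hcrit
    (yf_pos hpos₂ δ) (zf_eq u₂ δ p)
    (hasDerivAt_yf hdiff₂ δ) (hasDerivAt_zf hδp hsum hpos₂ hode₂) (by rw [hval₂, hcrit])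
  refine ⟨key, fun r hr => ?_⟩
  have h := (key (Real.log r)).1
  rw [yf, yf, Real.exp_log hr] at h
  exact mul_left_cancel₀ (Real.exp_pos _).ne' h
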